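/- Let S be a commutative monoid, let E₁ and E₂ be complex Banach spaces, and let T₁ : S → L(E₁) and T₂ : S → L(E₂) be bounded representations. Consider the direct sum representation T₁ ⊕ T₂ on the product Banach space E₁ × E₂ (with norm ‖(x₁,x₂)‖ = max(‖x₁‖,‖x₂‖)), given by (T₁⊕T₂)(s)(x₁,x₂) = (T₁(s)x₁, T₂(s)x₂). Then σ_uni(T₁ ⊕ T₂) = σ_uni(T₁) ∪ σ_uni(T₂). -/

import Mathlib

open Filter Topology

universe u

section Defs

variable {S : Type*} [AddCommMonoid S]

/-- A representation of a commutative monoid `S` in a monoid `A`. -/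
def IsRepresentation {A : Type*} [Monoid A] (T : S → A) : Prop :=
  T 0 = 1 ∧ ∀ s t : S, T (s + t) = T s * T t

/-- A bounded representation. -/
def IsBoundedRep {A : Type*} [Monoid A] [Norm A] (T : S → A) : Prop :=
  IsRepresentation T ∧ ∃ M : ℝ, ∀ s : S, ‖T s‖ ≤ M

/-- A unitary semigroup character of `S`. -/
def IsUnitaryChar (χ : S → ℂ) : Prop :=
  χ 0 = 1 ∧ (∀ s t : S, χ (s + t) = χ s * χ t) ∧ ∀ s : S, ‖χ s‖ = 1

/-- Membership in the unitary spectrum of a bounded representation: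
`χ` is a unitary semigroup character satisfying
`|∑ₖ βₖ χ(sₖ)| ≤ ‖∑ₖ βₖ T(sₖ)‖` for all finite families. -/
def InUniSpec {A : Type*} [NormedRing A] [NormedAlgebra ℂ A] (T : S → A) (χ : S → ℂ) : Prop :=
  IsUnitaryChar χ ∧ ∀ (n : ℕ) (s : Fin n → S) (β : Fin n → ℂ),
    ‖∑ k, β k * χ (s k)‖ ≤ ‖∑ k, β k • T (s k)‖

/-- A directed index set for nets: a nonempty preordered set in which every pair
of elements has an upper bound. -/
structure DirIdx : Type (u + 1) where
  J : Type u
  r : J → J → Prop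
  refl : ∀ j, r j j
  trans : ∀ {a b c}, r a b → r b c → r a c
  directed : ∀ a b, ∃ k, r a k ∧ r b k
  nonempty : Nonempty J

/-- Convergence of a net in a (semi)normed additive group. -/
def TendstoAlong {A : Type*} [SeminormedAddGroup A] (D : DirIdx.{u}) (f : D.J → A) (L : A) : Prop :=
  ∀ ε > 0, ∃ j₀ : D.J, ∀ j : D.J, D.r j₀ j → ‖f j - L‖ ≤ ε

end Defs

open AddMonoidAlgebra in
theorem exists_fin_sum {S : Type*} [AddCommMonoid S] (c : AddMonoidAlgebra ℂ S) :
    ∃ (n : ℕ) (s : Fin n → S) (β : Fin n → ℂ), c = ∑ k, single (s k) (β k) := by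
  induction c using AddMonoidAlgebra.induction_linear with
  | zero => exact ⟨0, Fin.elim0, Fin.elim0, by simp⟩
  | add f g hf hg =>
    obtain ⟨n, s, β, rfl⟩ := hf
    obtain ⟨m, t, γ, rfl⟩ := hg
    exact ⟨n + m, Fin.append s t, Fin.append β γ, by simp [Fin.sum_univ_add]⟩
  | single a b => exact ⟨1, fun _ => a, fun _ => b, by simp⟩

/-- The algebra homomorphism induced by a representation. -/
noncomputable def repHom {S : Type*} [AddCommMonoid S] {A : Type*} [Ring A] [Algebra ℂ A]
    (T : S → A) (h : IsRepresentation T) : AddMonoidAlgebra ℂ S →ₐ[ℂ] A :=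
  AddMonoidAlgebra.lift ℂ A S
    { toFun := fun s => T s.toAdd, map_one' := h.1, map_mul' := fun s t => h.2 _ _ }

theorem repHom_single {S : Type*} [AddCommMonoid S] {A : Type*} [Ring A] [Algebra ℂ A]
    (T : S → A) (h : IsRepresentation T) (s : S) (b : ℂ) :
    repHom T h (AddMonoidAlgebra.single s b) = b • T s := by
  simp [repHom, AddMonoidAlgebra.lift_single]

/-- The convex semigroup generated by the normalized elements. -/
noncomputable def uniHull {S : Type*} [AddCommMonoid S] (χ : S → ℂ) :
    Set (AddMonoidAlgebra ℂ S) :=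
  convexHull ℝ (Set.range fun s => AddMonoidAlgebra.single s (χ s)⁻¹)

section hull
variable {S : Type*} [AddCommMonoid S] {χ : S → ℂ}

theorem uniHull_one (hχ : IsUnitaryChar χ) : (1 : AddMonoidAlgebra ℂ S) ∈ uniHull χ := by
  apply subset_convexHull
  exact ⟨0, by simp [hχ.1, AddMonoidAlgebra.one_def]⟩

theorem uniHull_mul (hχ : IsUnitaryChar χ) {c d : AddMonoidAlgebra ℂ S} (hc : c ∈ uniHull χ) (hd : d ∈ uniHull χ) :
    c * d ∈ uniHull χ := by
  have h1 : uniHull χ ⊆ {c | c * d ∈ uniHull χ} := by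
    refine convexHull_min ?_ ((convex_convexHull ℝ _).linear_preimage
      (LinearMap.mulRight ℝ d))
    rintro _ ⟨s, rfl⟩
    have h2 : uniHull χ ⊆ {d | AddMonoidAlgebra.single s (χ s)⁻¹ * d ∈ uniHull χ} := by
      refine convexHull_min ?_ ((convex_convexHull ℝ _).linear_preimage
        (LinearMap.mulLeft ℝ _))
      rintro _ ⟨t, rfl⟩
      apply subset_convexHull
      refine ⟨s + t, ?_⟩
      simp [AddMonoidAlgebra.single_mul_single, hχ.2.1, mul_comm]
    exact h2 hd
  exact h1 hc

theorem uniHull_pow (hχ : IsUnitaryChar χ) {c : AddMonoidAlgebra ℂ S} (hc : c ∈ uniHull χ) (n : ℕ) :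
    c ^ n ∈ uniHull χ := by
  induction n with
  | zero => simpa using uniHull_one hχ
  | succ n ih => rw [pow_succ]; exact uniHull_mul hχ ih hc

theorem uniHull_bound (hχ : IsUnitaryChar χ) {A : Type*} [NormedRing A] [NormedAlgebra ℂ A] (T : S → A)
    (h : IsRepresentation T) {M : ℝ} (hM : ∀ s, ‖T s‖ ≤ M) {c : AddMonoidAlgebra ℂ S}
    (hc : c ∈ uniHull χ) : ‖repHom T h c‖ ≤ M := by
  have h1 : uniHull χ ⊆ {c | repHom T h c ∈ Metric.closedBall (0 : A) M} := by
    refine convexHull_min ?_ ((convex_closedBall (0 : A) M).linear_preimage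
      ((repHom T h).toLinearMap.restrictScalars ℝ))
    rintro _ ⟨s, rfl⟩
    simp [repHom_single, norm_smul, hχ.2.2, hM]
  simpa using h1 hc

theorem uniHull_char (hχ : IsUnitaryChar χ) (h : IsRepresentation χ) {c : AddMonoidAlgebra ℂ S}
    (hc : c ∈ uniHull χ) : repHom χ h c = 1 := by
  have h1 : uniHull χ ⊆ {c | repHom χ h c ∈ ({1} : Set ℂ)} := by
    refine convexHull_min ?_ ((convex_singleton (1 : ℂ)).linear_preimage
      ((repHom χ h).toLinearMap.restrictScalars ℝ))
    rintro _ ⟨s, rfl⟩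
    have : χ s ≠ 0 := by
      intro h0
      have := hχ.2.2 s
      simp [h0] at this
    simp [repHom_single, this]
  simpa using h1 hc

theorem exists_avg (hχ : IsUnitaryChar χ) {A : Type*} [NormedRing A] [NormedAlgebra ℂ A] (T : S → A)
    (h : IsRepresentation T) {M : ℝ} (hM : ∀ s, ‖T s‖ ≤ M) (hx : IsRepresentation χ)
    (f : AddMonoidAlgebra ℂ S) : ∀ δ > 0, ∃ c ∈ uniHull χ,
      ‖repHom T h (c * (f - repHom χ hx f • 1))‖ < δ := by
  have hM0 : 0 ≤ M := (norm_nonneg _).trans (hM 0)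
  induction f using AddMonoidAlgebra.induction_linear with
  | zero => intro δ hδ; exact ⟨1, uniHull_one hχ, by simpa using hδ⟩
  | add f g hf hg =>
    intro δ hδ
    have hp : 0 < δ / (2 * (M + 1)) := by positivity
    obtain ⟨c, hc, hcf⟩ := hf _ hp
    obtain ⟨d, hd, hdg⟩ := hg _ hp
    refine ⟨c * d, uniHull_mul hχ hc hd, ?_⟩
    have e : c * d * (f + g - repHom χ hx (f + g) • 1) =
        d * (c * (f - repHom χ hx f • 1)) + c * (d * (g - repHom χ hx g • 1)) := by
      rw [map_add, add_smul]; ring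
    rw [e, map_add, map_mul _ d, map_mul _ c (d * _)]
    have b1 := uniHull_bound hχ T h hM hc
    have b2 := uniHull_bound hχ T h hM hd
    calc _ ≤ ‖repHom T h d‖ * ‖repHom T h (c * (f - repHom χ hx f • 1))‖ +
          ‖repHom T h c‖ * ‖repHom T h (d * (g - repHom χ hx g • 1))‖ :=
          (norm_add_le _ _).trans (add_le_add (norm_mul_le _ _) (norm_mul_le _ _))
      _ ≤ M * (δ / (2 * (M + 1))) + M * (δ / (2 * (M + 1))) := by gcongr
      _ < (M + 1) * (δ / (2 * (M + 1))) + (M + 1) * (δ / (2 * (M + 1))) := by gcongr <;> linarith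
      _ = δ := by field_simp; ring
  | single s b =>
    intro δ hδ
    have hs : χ s ≠ 0 := by
      intro h0
      have := hχ.2.2 s
      simp [h0] at this
    set u : AddMonoidAlgebra ℂ S := AddMonoidAlgebra.single s (χ s)⁻¹ with hu
    have huH : u ∈ uniHull χ := subset_convexHull _ _ ⟨s, rfl⟩
    obtain ⟨N, hN⟩ := exists_nat_gt (‖b * χ s‖ * (2 * M) / δ)
    have hN0 : (0 : ℝ) < N := lt_of_le_of_lt (by positivity) hN
    refine ⟨∑ i ∈ Finset.range N, (N : ℝ)⁻¹ • u ^ i, ?_, ?_⟩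
    · refine (convex_convexHull ℝ _).sum_mem (fun _ _ => by positivity) ?_
        (fun i _ => uniHull_pow hχ huH i)
      simp [hN0.ne']
    · have e1 : AddMonoidAlgebra.single s b - repHom χ hx (AddMonoidAlgebra.single s b) • 1 =
          (b * χ s) • (u - 1) := by
        rw [repHom_single, smul_sub, hu, AddMonoidAlgebra.smul_single]
        simp [mul_assoc, hs]
      have e2 : (∑ i ∈ Finset.range N, (N : ℝ)⁻¹ • u ^ i) * ((b * χ s) • (u - 1)) =
          ((N : ℂ)⁻¹ * (b * χ s)) • (u ^ N - 1) := by
        rw [← Finset.smul_sum, ← geom_sum_mul u N, smul_mul_assoc, mul_smul_comm, mul_smul,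
          ← Complex.coe_smul]
        simp [mul_smul]
      rw [e1, e2, map_smul, map_sub, norm_smul]
      have b1 := uniHull_bound hχ T h hM (uniHull_pow hχ huH N)
      have b2 := uniHull_bound hχ T h hM (uniHull_one hχ)
      have b3 : ‖repHom T h (u ^ N) - repHom T h 1‖ ≤ 2 * M :=
        (norm_sub_le _ _).trans (by linarith)
      rw [div_lt_iff₀ hδ] at hN
      calc _ ≤ ‖(N : ℂ)⁻¹ * (b * χ s)‖ * (2 * M) := by gcongr
        _ = (N : ℝ)⁻¹ * (‖b * χ s‖ * (2 * M)) := by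
          rw [norm_mul, norm_inv, Complex.norm_natCast, mul_assoc]
        _ < (N : ℝ)⁻¹ * (N * δ) := by gcongr
        _ = δ := by field_simp

theorem exists_small (hχ : IsUnitaryChar χ) {A : Type*} [NormedRing A] [NormedAlgebra ℂ A] (T : S → A)
    (h : IsBoundedRep T) (hn : ¬ InUniSpec T χ) :
    ∀ ε > 0, ∃ c ∈ uniHull χ, ‖repHom T h.1 c‖ < ε := by
  intro ε hε
  obtain ⟨h, M, hM⟩ := h
  have hx : IsRepresentation χ := ⟨hχ.1, hχ.2.1⟩
  unfold InUniSpec at hn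
  push Not at hn
  obtain ⟨n, s, β, hlt⟩ := hn hχ
  obtain ⟨f, hf⟩ : ∃ f : AddMonoidAlgebra ℂ S, ‖repHom T h f‖ < ‖repHom χ hx f‖ :=
    ⟨∑ k, AddMonoidAlgebra.single (s k) (β k), by simpa [repHom_single] using hlt⟩
  have hp : 0 < ‖repHom χ hx f‖ := (norm_nonneg _).trans_lt hf
  obtain ⟨c, hc, hcf⟩ := exists_avg hχ T h hM hx f
    (ε * (‖repHom χ hx f‖ - ‖repHom T h f‖)) (mul_pos hε (by linarith))
  refine ⟨c, hc, ?_⟩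
  set z := repHom χ hx f
  have e : z • repHom T h c = repHom T h c * repHom T h f - repHom T h (c * (f - z • 1)) := by
    rw [← map_mul, ← map_sub, ← map_smul]
    congr 1
    rw [mul_sub, mul_smul_comm, mul_one]; abel
  have : ‖z‖ * ‖repHom T h c‖ ≤
      ‖repHom T h c‖ * ‖repHom T h f‖ + ‖repHom T h (c * (f - z • 1))‖ := by
    rw [← norm_smul, e]
    exact (norm_sub_le _ _).trans (by gcongr; exact norm_mul_le _ _)
  by_contra! hcon
  nlinarith [mul_le_mul_of_nonneg_right hcon (by linarith : 0 ≤ ‖z‖ - ‖repHom T h f‖)]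

end hull

section prod
variable {E₁ : Type*} [NormedAddCommGroup E₁] [NormedSpace ℂ E₁]
    {E₂ : Type*} [NormedAddCommGroup E₂] [NormedSpace ℂ E₂]

theorem norm_prodMap_le_max (f : E₁ →L[ℂ] E₁) (g : E₂ →L[ℂ] E₂) :
    ‖f.prodMap g‖ ≤ max ‖f‖ ‖g‖ := by
  refine ContinuousLinearMap.opNorm_le_bound _ (by positivity) fun x => ?_
  have h1 := f.le_opNorm x.1
  have h2 := g.le_opNorm x.2
  rw [ContinuousLinearMap.coe_prodMap', Prod.norm_def]
  refine max_le (h1.trans ?_) (h2.trans ?_)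
  · gcongr
    · exact le_max_left _ _
    · exact norm_fst_le x
  · gcongr
    · exact le_max_right _ _
    · exact norm_snd_le x

theorem norm_left_le_prodMap (f : E₁ →L[ℂ] E₁) (g : E₂ →L[ℂ] E₂) :
    ‖f‖ ≤ ‖f.prodMap g‖ := by
  refine ContinuousLinearMap.opNorm_le_bound _ (by positivity) fun x => ?_
  have := (f.prodMap g).le_opNorm (x, 0)
  simpa [Prod.norm_def] using this

theorem norm_right_le_prodMap (f : E₁ →L[ℂ] E₁) (g : E₂ →L[ℂ] E₂) :
    ‖g‖ ≤ ‖f.prodMap g‖ := by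
  refine ContinuousLinearMap.opNorm_le_bound _ (by positivity) fun x => ?_
  have := (f.prodMap g).le_opNorm (0, x)
  simpa [Prod.norm_def] using this

theorem sum_smul_prodMap {n : ℕ} (β : Fin n → ℂ) (f : Fin n → E₁ →L[ℂ] E₁)
    (g : Fin n → E₂ →L[ℂ] E₂) :
    ∑ k, β k • (f k).prodMap (g k) = (∑ k, β k • f k).prodMap (∑ k, β k • g k) := by
  refine ContinuousLinearMap.ext fun x => ?_
  apply Prod.ext <;>
    simp [Prod.fst_sum, Prod.snd_sum]

end prod

/-- For bounded representations `T₁ : S → L(E₁)` and `T₂ : S → L(E₂)`,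
the unitary spectrum of the direct sum representation `(T₁ ⊕ T₂)(s) = T₁(s) × T₂(s)`
on `E₁ × E₂` (with the sup norm) is `σ_uni(T₁) ∪ σ_uni(T₂)`. -/
theorem uniSpec_prod {S : Type*} [AddCommMonoid S]
    {E₁ : Type*} [NormedAddCommGroup E₁] [NormedSpace ℂ E₁] [CompleteSpace E₁]
    {E₂ : Type*} [NormedAddCommGroup E₂] [NormedSpace ℂ E₂] [CompleteSpace E₂]
    (T₁ : S → E₁ →L[ℂ] E₁) (hT₁ : IsBoundedRep T₁)
    (T₂ : S → E₂ →L[ℂ] E₂) (hT₂ : IsBoundedRep T₂) :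
    {χ : S → ℂ | InUniSpec (fun s => (T₁ s).prodMap (T₂ s)) χ} =
      {χ : S → ℂ | InUniSpec T₁ χ} ∪ {χ : S → ℂ | InUniSpec T₂ χ} := by
  ext χ
  simp only [Set.mem_setOf_eq, Set.mem_union]
  constructor
  · rintro ⟨hχ, hle⟩
    by_contra hcon
    rw [not_or] at hcon
    obtain ⟨M₁, hM₁⟩ := hT₁.2
    obtain ⟨M₂, hM₂⟩ := hT₂.2
    have hx : IsRepresentation χ := ⟨hχ.1, hχ.2.1⟩
    have p1 : 0 ≤ M₁ := (norm_nonneg _).trans (hM₁ 0)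
    have p2 : 0 ≤ M₂ := (norm_nonneg _).trans (hM₂ 0)
    obtain ⟨c, hc, hc1⟩ := exists_small hχ T₁ hT₁ hcon.1 (1 / (M₂ + M₁ + 1)) (by positivity)
    obtain ⟨d, hd, hd2⟩ := exists_small hχ T₂ hT₂ hcon.2 (1 / (M₂ + M₁ + 1)) (by positivity)
    rw [lt_div_iff₀ (by positivity)] at hc1 hd2
    have b1 := uniHull_bound hχ T₁ hT₁.1 hM₁ hd
    have b2 := uniHull_bound hχ T₂ hT₂.1 hM₂ hc
    have k1 : ‖repHom T₁ hT₁.1 (c * d)‖ < 1 := by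
      rw [map_mul]
      refine (norm_mul_le _ _).trans_lt (lt_of_le_of_lt ?_ hc1)
      gcongr
      linarith
    have k2 : ‖repHom T₂ hT₂.1 (c * d)‖ < 1 := by
      rw [map_mul]
      refine (norm_mul_le _ _).trans_lt (lt_of_le_of_lt ?_ hd2)
      rw [mul_comm]
      gcongr
      linarith
    have k3 := uniHull_char hχ hx (uniHull_mul hχ hc hd)
    obtain ⟨n, s, β, e⟩ := exists_fin_sum (c * d)
    rw [e] at k1 k2 k3
    simp only [map_sum, repHom_single, smul_eq_mul] at k1 k2 k3
    have := hle n s β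
    rw [k3, sum_smul_prodMap, norm_one] at this
    exact absurd (this.trans (norm_prodMap_le_max _ _)) (not_le.mpr (max_lt k1 k2))
  · rintro (⟨hχ, hle⟩ | ⟨hχ, hle⟩)
    · refine ⟨hχ, fun n s β => (hle n s β).trans ?_⟩
      rw [sum_smul_prodMap]
      exact norm_left_le_prodMap _ _
    · refine ⟨hχ, fun n s β => (hle n s β).trans ?_⟩
      rw [sum_smul_prodMap]
      exact norm_right_le_prodMap _ _
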